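/- Suppose n = 1, so that 𝕂 = ℚ(√(ε₀√l)). Then r₂(H) = 0, i.e. the 2-class group of 𝕂 is trivial. -/

import Mathlib

/-- `ε` is the fundamental unit of the real quadratic field `ℚ(√l)` (viewed inside `ℝ`):
it lies in `ℚ(√l)`, it is a unit of the ring of integers (both `ε` and `ε⁻¹` are
algebraic integers), `ε > 1`, and it is the smallest such unit. -/
def IsFundamentalUnit (l : ℕ) (ε : ℝ) : Prop :=
  1 < ε ∧ ε ∈ IntermediateField.adjoin ℚ ({Real.sqrt (l : ℝ)} : Set ℝ) ∧
    IsIntegral ℤ ε ∧ IsIntegral ℤ ε⁻¹ ∧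
    ∀ x : ℝ, 1 < x → x ∈ IntermediateField.adjoin ℚ ({Real.sqrt (l : ℝ)} : Set ℝ) →
      IsIntegral ℤ x → IsIntegral ℤ x⁻¹ → ε ≤ x

/-- The Legendre symbol `(a/p)`, via Euler's criterion (so that no `Fact p.Prime`
instance is needed): for an odd prime `p` it is `1` if `a` is a nonzero square mod `p`,
`0` if `p ∣ a`, and `-1` otherwise. -/
def legSym (p : ℕ) (a : ℤ) : ℤ :=
  if (a : ZMod p) ^ ((p - 1) / 2) = 1 then 1 else if (a : ZMod p) = 0 then 0 else -1

/-- The rational fourth power residue symbol `(a/p)₄ ∈ {±1}`, meaningful when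
`(a/p) = 1`; it is determined by `(a/p)₄ ≡ a ^ ((p-1)/4) (mod p)`. -/
def quartSym (p : ℕ) (a : ℤ) : ℤ :=
  if (a : ZMod p) ^ ((p - 1) / 4) = 1 then 1 else -1

/-- The cardinality of the 2-torsion subgroup of the class group of `K`.
For a number field `K` this equals `2 ^ r₂(H)`, where `r₂(H)` is the rank of the
2-class group `H` of `K` (i.e. `dim_{𝔽₂} Cl(K)/Cl(K)²`); in particular
`r₂(H) = r` iff this cardinality is `2 ^ r`. -/
noncomputable def twoTorsCard (K : IntermediateField ℚ ℝ) : ℕ :=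
  Nat.card {x : ClassGroup (NumberField.RingOfIntegers K) // x ^ 2 = 1}

section

open NumberField Ideal
open scoped Pointwise

theorem smul_span_singleton {R G : Type*} [CommRing R] [Group G] [MulSemiringAction G R] (τ : G)
    (a : R) :
    τ • span {a} = span {τ • a} := by
  rw [Ideal.smul_closure, Set.smul_set_singleton]

theorem smul_eq_of_generator {G M : Type*} [Group G] [MulAction G M] {σ : G}
    (hσ : ∀ τ, τ ∈ Subgroup.zpowers σ) {x : M} (hx : σ • x = x) (τ : G) : τ • x = x := by
  have : Subgroup.zpowers σ ≤ MulAction.stabilizer G x := by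
    rw [Subgroup.zpowers_le]
    exact hx
  exact this (hσ τ)

theorem norm_smul_eq {K : Type*} [Field K] [NumberField K] (σ : Gal(K/ℚ)) (x : 𝓞 K) :
    Algebra.norm ℚ ((σ • x : 𝓞 K) : K) = Algebra.norm ℚ (x : K) :=
  Algebra.norm_eq_of_algEquiv σ (x : K)

section

variable {K : Type*} [Field K] [NumberField K]

theorem le_map_under_of_inertia_eq_bot [IsGalois ℚ K] {P J : Ideal (𝓞 K)} [P.IsPrime] (hP : P ≠ ⊥)
    (hI : P.inertia Gal(K/ℚ) = ⊥) (hJ : ∀ τ : Gal(K/ℚ), τ • J = J) (hJP : J ≤ P) :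
    J ≤ (P.under ℤ).map (algebraMap ℤ (𝓞 K)) := by
  have hp0 : P.under ℤ ≠ ⊥ := Ideal.under_ne_bot ℤ hP
  have : P.LiesOver (P.under ℤ) := ⟨rfl⟩
  generalize P.under ℤ = p at *
  have hpr : p.IsPrime := P.over_def p ▸ inferInstance
  have : p.IsMaximal := hpr.isMaximal hp0
  have hfin : Finite (ℤ ⧸ p) := Ring.HasFiniteQuotients.finiteQuotient hp0
  have hram : Ideal.ramificationIdxIn p (𝓞 K) = 1 := by
    rw [← card_inertia_eq_ramificationIdxIn (G := Gal(K/ℚ)) p P, hI]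
    simp
  rw [Ideal.map_algebraMap_eq_finsetProd_pow hp0, ← Ideal.dvd_iff_le]
  have hQ1 (Q : Ideal (𝓞 K)) (hQ : Q ∈ (p.primesOver (𝓞 K)).toFinset) :
      Q ^ Q.ramificationIdx ℤ = Q := by
    obtain ⟨hQp, hQl⟩ := Set.mem_toFinset.1 hQ
    rw [← ramificationIdxIn_eq_ramificationIdx p Q Gal(K/ℚ), hram, pow_one]
  rw [Finset.prod_congr rfl hQ1]
  refine Finset.prod_primes_dvd _ (fun Q hQ ↦ ?_) (fun Q hQ ↦ ?_)
  · obtain ⟨hQp, hQl⟩ := Set.mem_toFinset.1 hQ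
    exact Ideal.prime_of_isPrime (Ideal.ne_bot_of_liesOver_of_ne_bot hp0 Q) hQp
  · obtain ⟨hQp, hQl⟩ := Set.mem_toFinset.1 hQ
    obtain ⟨τ, hτ⟩ := exists_smul_eq_of_isGaloisGroup p P Q Gal(K/ℚ)
    rw [Ideal.dvd_iff_le, ← hJ τ, ← hτ]
    exact Ideal.pointwise_smul_le_pointwise_smul_iff.2 hJP

theorem exists_eq_span_of_invariant [IsGalois ℚ K] {θ : 𝓞 K} (hθ : Prime θ)
    (hθσ : ∀ τ : Gal(K/ℚ), τ • span {θ} = span {θ})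
    (hin : ∀ P : Ideal (𝓞 K), P.IsPrime → P ≠ ⊥ → θ ∉ P → P.inertia Gal(K/ℚ) = ⊥)
    (J : Ideal (𝓞 K)) (hJ0 : J ≠ ⊥) (hJ : ∀ τ : Gal(K/ℚ), τ • J = J) :
    ∃ (q : ℤ) (j : ℕ), q ≠ 0 ∧ J = span {(q : 𝓞 K) * θ ^ j} := by
  induction hn : absNorm J using Nat.strong_induction_on generalizing J with
  | _ n ih =>
  subst hn
  have step (a : 𝓞 K) (ha0 : a ≠ 0) (ha : ¬ IsUnit a)
      (haσ : ∀ τ : Gal(K/ℚ), τ • span {a} = span {a}) (hJa : J ≤ span {a}) :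
      ∃ (q : ℤ) (j : ℕ), q ≠ 0 ∧ J = span {a} * span {(q : 𝓞 K) * θ ^ j} := by
    have hs0 : span {a} ≠ ⊥ := by simpa using ha0
    obtain ⟨J', rfl⟩ := Ideal.dvd_iff_le.2 hJa
    have hJ'0 : J' ≠ ⊥ := by rintro rfl; simp at hJ0
    obtain ⟨q, j, hq, h⟩ := ih (absNorm J') (by
      rw [map_mul]
      have h1 : absNorm (span {a}) ≠ 0 := by rwa [Ne, absNorm_eq_zero_iff]
      have h2 : absNorm (span {a}) ≠ 1 := by
        rwa [Ne, absNorm_eq_one_iff, Ideal.span_singleton_eq_top]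
      have h3 : absNorm J' ≠ 0 := by rwa [Ne, absNorm_eq_zero_iff]
      exact lt_mul_of_one_lt_left (by positivity) (by omega)) J' hJ'0 (fun τ ↦ by
        have := hJ τ
        rw [smul_mul', haσ] at this
        exact mul_left_cancel₀ hs0 this) rfl
    exact ⟨q, j, hq, by rw [h]⟩
  by_cases htop : J = ⊤
  · exact ⟨1, 0, one_ne_zero, by simp [htop]⟩
  obtain ⟨P, hPm, hJP⟩ := Ideal.exists_le_maximal J htop
  have hP0 : P ≠ ⊥ := by rintro rfl; exact hJ0 (le_bot_iff.1 hJP)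
  by_cases hP : θ ∈ P
  · have hθP : span {θ} = P := by
      have h := (Ideal.span_singleton_prime hθ.ne_zero).2 hθ
      exact (h.isMaximal (by simpa using hθ.ne_zero)).eq_of_le hPm.ne_top
        ((Ideal.span_singleton_le_iff_mem P).2 hP)
    obtain ⟨q, j, hq, h⟩ := step θ hθ.ne_zero hθ.not_isUnit hθσ (hθP ▸ hJP)
    refine ⟨q, j + 1, hq, ?_⟩
    rw [h, Ideal.span_singleton_mul_span_singleton]
    congr 2
    ring
  · have hle := le_map_under_of_inertia_eq_bot hP0 (hin P hPm.isPrime hP0 hP) hJ hJP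
    obtain ⟨q, hq⟩ := (inferInstance : (P.under ℤ).IsPrincipal)
    have hq' : P.under ℤ = span {q} := hq
    have hq0 : q ≠ 0 := by
      rintro rfl
      exact Ideal.under_ne_bot ℤ hP0 (by simp [hq'])
    rw [hq', Ideal.map_span, Set.image_singleton] at hle
    obtain ⟨r, j, hr, h⟩ := step (q : 𝓞 K) (by exact_mod_cast hq0) (fun hu ↦ by
      have : q ∈ P.under ℤ := hq' ▸ Ideal.mem_span_singleton_self q
      exact hPm.ne_top (Ideal.eq_top_of_isUnit_mem P (by simpa [Ideal.under] using this) hu))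
      (fun τ ↦ by
        rw [smul_span_singleton]
        congr 2
        exact map_intCast (MulSemiringAction.toRingHom Gal(K/ℚ) (𝓞 K) τ) q) (by simpa using hle)
    refine ⟨q * r, j, mul_ne_zero hq0 hr, ?_⟩
    rw [h, Ideal.span_singleton_mul_span_singleton]
    congr 2
    push_cast
    ring

end

theorem exists_pow_mem_of_div_map_surjective {E : Type*} [CommGroup E]
    [Module.Finite ℤ (Additive E)] (S : Subgroup E) (s : E →* E)
    (hs : ∀ x, s (s (s (s x))) = x) (hS : ∀ x ∈ S, x / s x ∈ S)
    (h : ∀ u, ∃ v, u / (v / s v) ∈ S) : ∃ r : ℤ, r ≠ 0 ∧ ∀ u, u ^ r ∈ S := by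
  have hsq (u : E) : ∃ w, u / w ^ 2 ∈ S := by
    have lift (u x y : E) (hx : u / x ∈ S) (hy : x / y ∈ S) : u / y ∈ S := by
      have := S.mul_mem hx hy
      rwa [div_mul_div_cancel] at this
    have hD (x y : E) (hxy : x / y ∈ S) : (x / s x) / (y / s y) ∈ S := by
      have := hS _ hxy
      rwa [map_div, div_div_div_comm] at this
    obtain ⟨v₁, h₁⟩ := h u
    obtain ⟨v₂, h₂⟩ := h v₁
    obtain ⟨v₃, h₃⟩ := h v₂
    obtain ⟨v, h₄⟩ := h v₃
    have key := lift _ _ _ (lift _ _ _ (lift _ _ _ h₁ (hD _ _ h₂)) (hD _ _ (hD _ _ h₃)))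
      (hD _ _ (hD _ _ (hD _ _ h₄)))
    refine ⟨v * s v ^ (-2 : ℤ) * s (s v) ^ 3 * s (s (s v)) ^ (-2 : ℤ), ?_⟩
    convert key using 2
    simp only [map_div, hs]
    apply Additive.ofMul.injective
    simp only [ofMul_div, ofMul_mul, ofMul_pow, ofMul_zpow]
    module
  obtain ⟨r, hr, hr'⟩ := Submodule.exists_sub_one_mem_and_smul_eq_zero_of_fg_of_le_smul
    (M := Additive (E ⧸ S)) (span {(2 : ℤ)}) ⊤ (by
      have : Module.Finite ℤ (Additive (E ⧸ S)) :=
        Module.Finite.of_surjective (QuotientGroup.mk' S).toAdditive.toIntLinearMap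
          (QuotientGroup.mk'_surjective S)
      exact Module.Finite.fg_top) (fun x _ ↦ by
        obtain ⟨u, hu⟩ := QuotientGroup.mk'_surjective S x.toMul
        obtain ⟨w, hw⟩ := hsq u
        have hx : x = (2 : ℤ) • Additive.ofMul (w : E ⧸ S) := by
          apply Additive.toMul.injective
          rw [← hu, toMul_zsmul, toMul_ofMul, QuotientGroup.mk'_apply, ← QuotientGroup.mk_zpow]
          exact QuotientGroup.eq_iff_div_mem.2 (by exact_mod_cast hw)
        rw [hx]
        exact Submodule.smul_mem_smul (Ideal.mem_span_singleton_self _) trivial)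
  refine ⟨r, ?_, fun u ↦ ?_⟩
  · rintro rfl
    rw [Ideal.mem_span_singleton] at hr
    omega
  · have := hr' (Additive.ofMul (u : E ⧸ S)) trivial
    rw [← QuotientGroup.eq_one_iff]
    exact this

theorem finrank_le_one_of_pow_mem {E : Type*} [CommGroup E] [Module.Finite ℤ (Additive E)]
    (ε : E) (r : ℤ) (hr : r ≠ 0) (h : ∀ u : E, u ^ r ∈ Subgroup.zpowers ε) :
    Module.finrank ℤ (Additive E) ≤ 1 := by
  by_contra! hcon
  obtain ⟨f, hf⟩ := exists_linearIndependent_of_le_finrank hcon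
  obtain ⟨a, ha⟩ := h (f 0).toMul
  obtain ⟨b, hb⟩ := h (f 1).toMul
  have ha' : a • Additive.ofMul ε = r • f 0 := ha
  have hb' : b • Additive.ofMul ε = r • f 1 := hb
  rw [Fintype.linearIndependent_iff] at hf
  have h₁ := hf ![b * r, -(a * r)] (by
    simp only [Fin.sum_univ_two, Matrix.cons_val_zero, Matrix.cons_val_one, mul_smul, neg_smul,
      ← ha', ← hb']
    module) 1
  have h₂ : a = 0 := by simpa [hr] using h₁
  have h₃ := hf ![r, 0] (by simp [Fin.sum_univ_two, ← ha', h₂]) 0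
  exact hr (by simpa using h₃)

section

variable {K : Type} [Field K] [NumberField K] [IsGalois ℚ K] {σ : Gal(K/ℚ)}

theorem exists_mul_smul_eq_mul (hσ : ∀ τ, τ ∈ Subgroup.zpowers σ) {a b : 𝓞 K} (ha : a ≠ 0)
    (h : Algebra.norm ℚ (b : K) = Algebra.norm ℚ (a : K)) :
    ∃ β : 𝓞 K, β ≠ 0 ∧ b * σ • β = a * β := by
  have ha' : (a : K) ≠ 0 := by exact_mod_cast ha
  have hx : Algebra.norm ℚ ((b : K) / a) = 1 := by
    rw [div_eq_mul_inv, map_mul, Algebra.norm_inv, h,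
      mul_inv_cancel₀ (Algebra.norm_ne_zero_iff.2 ha')]
  have : IsCyclic Gal(K/ℚ) := ⟨σ, hσ⟩
  obtain ⟨y, hy⟩ := groupCohomology.exists_div_of_norm_eq_one hσ hx
  obtain ⟨d, hd, hInt⟩ := exists_integral_multiples ℤ ℚ {(y : K)}
  have hInt' := hInt y (by simp)
  have hσy : σ (y : K) ≠ 0 := by simp
  obtain ⟨β, hβ⟩ : ∃ β : 𝓞 K, (β : K) = d • (y : K) := ⟨⟨_, hInt'⟩, rfl⟩
  refine ⟨β, ?_, ?_⟩
  · rintro rfl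
    simp [hd] at hβ
  · apply RingOfIntegers.ext
    have hsm : ((σ • β : 𝓞 K) : K) = σ (β : K) := rfl
    simp only [RingOfIntegers.coe_eq_algebraMap] at hsm hβ hy ⊢
    rw [map_mul, map_mul, hsm, hβ, map_zsmul]
    rw [div_eq_div_iff hσy ha'] at hy
    simp only [zsmul_eq_mul]
    linear_combination -(d : K) * hy

theorem exists_unit_norm_eq_neg_one (hσ : ∀ τ, τ ∈ Subgroup.zpowers σ) (hσ4 : σ ^ 4 = 1)
    {θ : 𝓞 K} (hθ : Prime θ)
    (hin : ∀ P : Ideal (𝓞 K), P.IsPrime → P ≠ ⊥ → θ ∉ P → P.inertia Gal(K/ℚ) = ⊥)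
    {ε : (𝓞 K)ˣ} (hθσ : θ = ε * σ • θ) (hεσ : (ε : 𝓞 K) * σ • (ε : 𝓞 K) = -1)
    (hrank : 1 < Units.rank K) : ∃ u : (𝓞 K)ˣ, Algebra.norm ℚ (u : K) = -1 := by
  by_contra! hcon
  have hnorm (u : (𝓞 K)ˣ) : Algebra.norm ℚ (u : K) = 1 :=
    ((abs_eq zero_le_one).1 (NumberField.Units.norm K u)).resolve_right (hcon u)
  let s : (𝓞 K)ˣ →* (𝓞 K)ˣ :=
    Units.map (MulSemiringAction.toRingHom Gal(K/ℚ) (𝓞 K) σ).toMonoidHom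
  have hs (u : (𝓞 K)ˣ) : (s u : 𝓞 K) = σ • (u : 𝓞 K) := rfl
  have hsε : s ε = -ε⁻¹ := by
    rw [← mul_right_inj ε]
    ext
    simp [hs, hεσ]
  have hspan : σ • span {θ} = span {θ} := by
    rw [smul_span_singleton]
    conv_rhs => rw [hθσ]
    exact (Ideal.span_singleton_mul_left_unit ε.isUnit _).symm
  obtain ⟨r, hr, hrmem⟩ := exists_pow_mem_of_div_map_surjective
    ((Subgroup.zpowers (ε ^ 2)).comap (powMonoidHom 2)) s
    (fun x ↦ by
      ext
      simp only [hs, smul_smul]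
      rw [show σ * (σ * (σ * σ)) = 1 by
        rw [← hσ4]; simp only [pow_succ, pow_zero, one_mul, mul_assoc], one_smul])
    (fun x hx ↦ by
      obtain ⟨j, hj⟩ := hx
      refine ⟨2 * j, ?_⟩
      have hj' : x ^ 2 = (ε ^ 2) ^ j := hj.symm
      simp only [powMonoidHom_apply, div_pow, ← map_pow, hj']
      rw [map_zpow, map_pow, hsε, neg_sq, ← div_zpow, inv_pow, div_inv_eq_mul, ← pow_two, zpow_mul]
      norm_cast)
    (fun u ↦ by
      obtain ⟨β, hβ0, hβ⟩ := exists_mul_smul_eq_mul hσ (a := 1) (b := (u : 𝓞 K)) one_ne_zero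
        (by simpa using hnorm u)
      rw [one_mul] at hβ
      have hinv : σ • span {β} = span {β} := by
        rw [smul_span_singleton, ← Ideal.span_singleton_mul_left_unit u.isUnit, hβ]
      obtain ⟨q, j, hq, h⟩ := exists_eq_span_of_invariant hθ (smul_eq_of_generator hσ hspan) hin
        (span {β}) (by simpa using hβ0) (smul_eq_of_generator hσ hinv)
      obtain ⟨v, hv⟩ := Ideal.span_singleton_eq_span_singleton.1 h.symm
      refine ⟨v, ⟨j, ?_⟩⟩
      have hσq : σ • (q : 𝓞 K) = q :=
        map_intCast (MulSemiringAction.toRingHom Gal(K/ℚ) (𝓞 K) σ) q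
      have hv' : (q : 𝓞 K) * (σ • θ) ^ j * s v = σ • β := by
        rw [← hv, smul_mul', smul_mul', hσq, smul_pow', hs]
      have hne : (q : 𝓞 K) * (σ • θ) ^ j ≠ 0 := by
        refine mul_ne_zero (by exact_mod_cast hq) (pow_ne_zero _ ?_)
        rintro h0
        exact hθ.ne_zero (by rw [hθσ, h0, mul_zero])
      have hu : u * s v = ε ^ j * v := by
        apply Units.ext
        apply mul_left_cancel₀ hne
        rw [← hv', ← hv] at hβ
        push_cast
        calc _ = (u : 𝓞 K) * (q * (σ • θ) ^ j * s v) := by ring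
          _ = _ := by
            rw [hβ]
            conv_lhs => rw [hθσ]
            rw [mul_pow]
            ring
      rw [← div_mul, div_mul_eq_mul_div, hu, mul_div_cancel_right]
      simp only [powMonoidHom_apply]
      rw [zpow_natCast, ← pow_mul, ← pow_mul, mul_comm])
  have hle := finrank_le_one_of_pow_mem ε (2 * r) (by omega) (fun u ↦ by
    obtain ⟨j, hj⟩ := hrmem u
    refine ⟨2 * j, ?_⟩
    have hj' : (ε ^ 2) ^ j = (u ^ r) ^ 2 := hj
    simp only
    rw [zpow_mul, mul_comm 2 r, zpow_mul]
    exact_mod_cast hj')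
  rw [Units.finrank_eq] at hle
  omega

theorem isPrincipal_of_span_mul_smul_eq (hσ : ∀ τ, τ ∈ Subgroup.zpowers σ) (hσ4 : σ ^ 4 = 1)
    {θ : 𝓞 K} (hθ : Prime θ)
    (hin : ∀ P : Ideal (𝓞 K), P.IsPrime → P ≠ ⊥ → θ ∉ P → P.inertia Gal(K/ℚ) = ⊥)
    {ε : (𝓞 K)ˣ} (hθσ : θ = ε * σ • θ) (hεσ : (ε : 𝓞 K) * σ • (ε : 𝓞 K) = -1)
    (hrank : 1 < Units.rank K) {I : Ideal (𝓞 K)} (hI : I ≠ ⊥) {a b : 𝓞 K} (ha : a ≠ 0)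
    (hab : span {a} * σ • I = span {b} * I)
    (hnorm : Algebra.norm ℚ (b : K) = Algebra.norm ℚ (a : K) ∨
      Algebra.norm ℚ (b : K) = -Algebra.norm ℚ (a : K)) : I.IsPrincipal := by
  wlog h : Algebra.norm ℚ (b : K) = Algebra.norm ℚ (a : K) generalizing b
  · obtain ⟨u, hu⟩ := exists_unit_norm_eq_neg_one hσ hσ4 hθ hin hθσ hεσ hrank
    have h' : Algebra.norm ℚ ((u * b : 𝓞 K) : K) = Algebra.norm ℚ (a : K) := by
      simp only [RingOfIntegers.coe_eq_algebraMap] at hnorm h ⊢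
      rw [map_mul, map_mul, hu, hnorm.resolve_left h]
      ring
    exact this (by rwa [Ideal.span_singleton_mul_left_unit u.isUnit]) (.inl h') h'
  obtain ⟨β, hβ0, hβ⟩ := exists_mul_smul_eq_mul hσ ha h
  have hspan : σ • span {θ} = span {θ} := by
    rw [smul_span_singleton]
    conv_rhs => rw [hθσ]
    exact (Ideal.span_singleton_mul_left_unit ε.isUnit _).symm
  have hinv : σ • (span {β} * I) = span {β} * I := by
    have ha0 : span {a} ≠ ⊥ := by simpa using ha
    apply mul_left_cancel₀ ha0
    calc span {a} * σ • (span {β} * I) = span {σ • β} * (span {a} * σ • I) := by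
          rw [smul_mul', smul_span_singleton]
          ring
      _ = span {a} * (span {β} * I) := by
          rw [hab, ← mul_assoc, ← mul_assoc, Ideal.span_singleton_mul_span_singleton,
            Ideal.span_singleton_mul_span_singleton, ← hβ, mul_comm b]
  obtain ⟨q, j, hq, hJ⟩ := exists_eq_span_of_invariant hθ (smul_eq_of_generator hσ hspan) hin
    (span {β} * I) (mul_ne_zero (by simpa using hβ0) hI) (smul_eq_of_generator hσ hinv)
  have hmem : (q : 𝓞 K) * θ ^ j ∈ span {β} * I := hJ ▸ Ideal.mem_span_singleton_self _
  obtain ⟨c, -, hc⟩ := Ideal.mem_span_singleton_mul.1 hmem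
  rw [← hc, ← Ideal.span_singleton_mul_span_singleton, Ideal.span_singleton_mul_right_inj hβ0] at hJ
  exact ⟨c, hJ⟩

theorem isPrincipal_of_mul_smul_isPrincipal (hσ : ∀ τ, τ ∈ Subgroup.zpowers σ) (hσ4 : σ ^ 4 = 1)
    {θ : 𝓞 K} (hθ : Prime θ)
    (hin : ∀ P : Ideal (𝓞 K), P.IsPrime → P ≠ ⊥ → θ ∉ P → P.inertia Gal(K/ℚ) = ⊥)
    {ε : (𝓞 K)ˣ} (hθσ : θ = ε * σ • θ) (hεσ : (ε : 𝓞 K) * σ • (ε : 𝓞 K) = -1)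
    (hrank : 1 < Units.rank K) {I : Ideal (𝓞 K)} (hI : I ≠ ⊥) (hI2 : ∃ c, I ^ 2 = span {c})
    (h : ∃ c, I * σ • I = span {c}) : ∃ c, I = span {c} := by
  obtain ⟨a, ha⟩ := hI2
  obtain ⟨b, hb⟩ := h
  have hI' : σ • I ≠ ⊥ := fun h0 ↦ hI (by rw [← inv_smul_smul σ I, h0, Ideal.smul_bot])
  have ha0 : a ≠ 0 := by
    rintro rfl
    exact pow_ne_zero 2 hI (by simpa using ha)
  have hab : span {a} * σ • I = span {b} * I := by
    rw [← ha, ← hb]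
    ring
  refine (isPrincipal_of_span_mul_smul_eq hσ hσ4 hθ hin hθσ hεσ hrank hI ha0 hab ?_).1
  have hsq : Associated (a * σ • a) (b ^ 2) := by
    rw [← Ideal.span_singleton_eq_span_singleton, ← Ideal.span_singleton_mul_span_singleton,
      ← smul_span_singleton, ← Ideal.span_singleton_pow, ← ha, ← hb, smul_pow']
    ring
  obtain ⟨u, hu⟩ := hsq
  have hN := congrArg (fun x : 𝓞 K ↦ Algebra.norm ℚ (x : K)) hu
  simp only [map_mul, map_pow, norm_smul_eq] at hN
  rw [← sq_eq_sq_iff_eq_or_eq_neg]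
  rcases (abs_eq zero_le_one).1 (NumberField.Units.norm K u) with h | h
  · rw [← hN, h]
    ring
  · rw [h] at hN
    have : 0 < Algebra.norm ℚ (a : K) ^ 2 :=
      sq_pos_of_ne_zero (Algebra.norm_ne_zero_iff.2 (by exact_mod_cast ha0))
    nlinarith [sq_nonneg (Algebra.norm ℚ (b : K))]

theorem isPrincipal_of_sq_isPrincipal (hσ : ∀ τ, τ ∈ Subgroup.zpowers σ) (hσ4 : σ ^ 4 = 1)
    {θ : 𝓞 K} (hθ : Prime θ)
    (hin : ∀ P : Ideal (𝓞 K), P.IsPrime → P ≠ ⊥ → θ ∉ P → P.inertia Gal(K/ℚ) = ⊥)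
    {ε : (𝓞 K)ˣ} (hθσ : θ = ε * σ • θ) (hεσ : (ε : 𝓞 K) * σ • (ε : 𝓞 K) = -1)
    (hrank : 1 < Units.rank K) {I : Ideal (𝓞 K)} (hI : I ≠ ⊥) (hI2 : ∃ c, I ^ 2 = span {c}) :
    ∃ c, I = span {c} := by
  have key (J : Ideal (𝓞 K)) := isPrincipal_of_mul_smul_isPrincipal hσ hσ4 hθ hin hθσ hεσ hrank
    (I := J)
  have hmul (J J' : Ideal (𝓞 K)) (h : ∃ c, J = span {c}) (h' : ∃ c, J' = span {c}) :
      ∃ c, J * J' = span {c} := by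
    obtain ⟨c, rfl⟩ := h
    obtain ⟨c', rfl⟩ := h'
    exact ⟨c * c', Ideal.span_singleton_mul_span_singleton c c'⟩
  have hsm (J : Ideal (𝓞 K)) (h : ∃ c, J = span {c}) : ∃ c, σ • J = span {c} := by
    obtain ⟨c, rfl⟩ := h
    exact ⟨_, smul_span_singleton σ c⟩
  have hsm0 (J : Ideal (𝓞 K)) (h : J ≠ ⊥) : σ • J ≠ ⊥ :=
    fun h0 ↦ h (by rw [← inv_smul_smul σ J, h0, Ideal.smul_bot])
  let N (J : Ideal (𝓞 K)) := J * σ • J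
  have hN0 (J : Ideal (𝓞 K)) (h : J ≠ ⊥) : N J ≠ ⊥ := mul_ne_zero h (hsm0 J h)
  have hN2 (J : Ideal (𝓞 K)) (h : ∃ c, J ^ 2 = span {c}) : ∃ c, N J ^ 2 = span {c} := by
    have := hmul _ _ h (hsm _ h)
    rwa [smul_pow', ← mul_pow] at this
  have hN4 : ∃ c, N (N (N (N I))) = span {c} := by
    have h1 := hsm _ hI2
    have h2 := hsm _ h1
    have h3 := hsm _ h2
    have := hmul _ _ (hmul _ _ hI2 (hmul _ _ h1 h1)) (hmul _ _ (hmul _ _ (hmul _ _ h2 h2) h2)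
      (hmul _ _ h3 h3))
    have h4 : σ • σ • σ • σ • I = I := by
      simp only [smul_smul]
      rw [show σ * (σ * (σ * σ)) = 1 by
        rw [← hσ4]; simp only [pow_succ, pow_zero, one_mul, mul_assoc], one_smul]
    convert this using 3
    simp only [N, smul_mul', smul_pow', h4]
    ring
  have h1 := hN0 _ hI
  have h2 := hN0 _ h1
  have h3 := hN0 _ h2
  exact key _ hI hI2 (key _ h1 (hN2 _ hI2) (key _ h2 (hN2 _ (hN2 _ hI2))
    (key _ h3 (hN2 _ (hN2 _ (hN2 _ hI2))) hN4)))

theorem classGroup_eq_one_of_sq_eq_one {R : Type*} [CommRing R] [IsDedekindDomain R]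
    (h : ∀ I : Ideal R, I ≠ ⊥ → (∃ c, I ^ 2 = span {c}) → ∃ c, I = span {c})
    (x : ClassGroup R) (hx : x ^ 2 = 1) : x = 1 := by
  obtain ⟨I, rfl⟩ := ClassGroup.mk0_surjective x
  rw [← map_pow, ClassGroup.mk0_eq_one_iff] at hx
  rw [ClassGroup.mk0_eq_one_iff]
  exact ⟨h I (nonZeroDivisors.coe_ne_zero I) hx.1⟩

end

theorem exists_int_eq_of_isIntegral {q : ℚ} {x : ℝ} (hx : x = q) (h : IsIntegral ℤ x) :
    ∃ a : ℤ, (a : ℚ) = q := by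
  subst hx
  exact IsIntegrallyClosed.isIntegral_iff.1
    ((isIntegral_algebraMap_iff (algebraMap ℚ ℝ).injective).1 h)

theorem sq_emod_eight (x : ℤ) : x % 2 = 1 ∧ x ^ 2 % 8 = 1 ∨ x % 4 = 2 ∧ x ^ 2 % 8 = 4 ∨
    x % 4 = 0 ∧ x ^ 2 % 8 = 0 := by
  have h : x % 8 = 0 ∨ x % 8 = 1 ∨ x % 8 = 2 ∨ x % 8 = 3 ∨ x % 8 = 4 ∨ x % 8 = 5 ∨ x % 8 = 6 ∨
    x % 8 = 7 := by omega
  rcases h with h | h | h | h | h | h | h | h <;> simp [sq, Int.mul_emod, h] <;> omega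

theorem four_dvd_of_sq_add_one_eq {l : ℕ} (hl8 : l % 8 = 1) {T U : ℤ} (hU : 0 < U)
    (h : T ^ 2 + 1 = l * U ^ 2) : 4 ∣ T ∧ 4 ∣ U - 1 := by
  have hsum : U % 4 ≠ 3 := by
    lift U to ℕ using hU.le
    have hsq : IsSquare (-1 : ZMod U) := by
      refine ⟨T, ?_⟩
      have := congrArg (Int.cast : ℤ → ZMod U) h
      push_cast at this
      rw [ZMod.natCast_self] at this
      linear_combination -this
    obtain ⟨x, y, rfl⟩ := Nat.eq_sq_add_sq_of_isSquare_mod_neg_one hsq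
    have hx := sq_emod_eight x
    have hy := sq_emod_eight y
    push_cast
    omega
  have hlU : (l : ℤ) * U ^ 2 = 8 * ((l / 8 : ℕ) * U ^ 2) + U ^ 2 := by
    rw [show (l : ℤ) = 8 * (l / 8 : ℕ) + 1 by omega]
    ring
  have hT := sq_emod_eight T
  have hU8 := sq_emod_eight U
  omega

theorem exists_eq_add_mul_sqrt {l : ℕ} (hl : l.Prime) (hl8 : l % 8 = 1) {ε : ℝ} (hε : 1 < ε)
    (hInt : IsIntegral ℤ ε) (hInt' : IsIntegral ℤ ε⁻¹) {u v : ℚ} (huv : ε = u + v * √l)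
    (hnorm : (u : ℝ) ^ 2 - v ^ 2 * l = -1) :
    ∃ T U : ℤ, ε = T + U * √l ∧ T ^ 2 + 1 = l * U ^ 2 ∧ 0 < U := by
  have hs : √(l : ℝ) ^ 2 = l := Real.sq_sqrt l.cast_nonneg
  have hs0 : 0 < √(l : ℝ) := Real.sqrt_pos.2 (by exact_mod_cast hl.pos)
  have hinv : ε⁻¹ = v * √l - u := by
    refine inv_eq_of_mul_eq_one_right ?_
    rw [huv]
    linear_combination (v : ℝ) ^ 2 * hs - hnorm
  obtain ⟨a, ha⟩ := exists_int_eq_of_isIntegral (q := 2 * u) (x := ε - ε⁻¹)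
    (by rw [hinv, huv]; push_cast; ring) (hInt.sub hInt')
  have hnorm' : u ^ 2 - v ^ 2 * l = -1 := by exact_mod_cast hnorm
  have hw : (2 * v * l) ^ 2 = algebraMap ℤ ℚ (l * (a ^ 2 + 4)) := by
    simp only [eq_intCast]
    push_cast
    rw [ha]
    linear_combination -4 * (l : ℚ) * hnorm'
  have hw1 : IsIntegral ℤ (2 * v * l) := .of_pow two_pos (hw ▸ isIntegral_algebraMap)
  obtain ⟨w, hw'⟩ := IsIntegrallyClosed.isIntegral_iff.1 hw1
  rw [← hw'] at hw
  simp only [eq_intCast] at hw hw'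
  have hww : w ^ 2 = l * (a ^ 2 + 4) := by exact_mod_cast hw
  obtain ⟨b, rfl⟩ := (Nat.prime_iff_prime_int.1 hl).dvd_of_dvd_pow ⟨_, hww⟩
  have hl0 : (l : ℤ) ≠ 0 := by exact_mod_cast hl.ne_zero
  have hb : (b : ℚ) = 2 * v := by
    have : (l : ℚ) ≠ 0 := by exact_mod_cast hl.ne_zero
    apply mul_left_cancel₀ this
    rw [mul_comm _ (2 * v), ← hw']
    push_cast
    ring
  have hab : a ^ 2 + 4 = l * b ^ 2 := by
    apply mul_left_cancel₀ hl0
    linear_combination -hww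
  have hlb : (l : ℤ) * b ^ 2 = 8 * ((l / 8 : ℕ) * b ^ 2) + b ^ 2 := by
    rw [show (l : ℤ) = 8 * (l / 8 : ℕ) + 1 by omega]
    ring
  have ha8 := sq_emod_eight a
  have hb8 := sq_emod_eight b
  obtain ⟨T, rfl⟩ : 2 ∣ a := by omega
  obtain ⟨U, rfl⟩ : 2 ∣ b := by omega
  push_cast at ha hb
  have hT : (T : ℚ) = u := by linarith
  have hU : (U : ℚ) = v := by linarith
  subst hT hU
  refine ⟨T, U, by simpa using huv, by linarith, ?_⟩
  have h1 : 0 < ε⁻¹ := by positivity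
  have h2 : 0 < (U : ℝ) * √l := by
    push_cast at hinv huv
    linarith
  exact_mod_cast (pos_iff_pos_of_mul_pos h2).2 hs0

open IntermediateField Polynomial

theorem irreducible_quartic {l : ℕ} (hl : l.Prime) {a : ℤ} (ha : (l : ℤ) ∣ a) :
    Irreducible (X ^ 4 - C (a : ℚ) * X ^ 2 + C (l : ℚ)) := by
  set p : ℤ[X] := X ^ 4 - C a * X ^ 2 + C (l : ℤ) with hp
  have hdeg : p.natDegree = 4 := by rw [hp]; compute_degree!
  have hmon : p.Monic := by rw [hp]; monicity!
  have hlp := Nat.prime_iff_prime_int.1 hl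
  have hirr : Irreducible p := by
    refine Polynomial.IsEisensteinAt.irreducible (𝓟 := Ideal.span {(l : ℤ)}) ⟨?_, ?_, ?_⟩
      ((Ideal.span_singleton_prime hlp.ne_zero).2 hlp) hmon.isPrimitive (by omega)
    · rw [hmon.leadingCoeff, Ideal.mem_span_singleton]
      exact hlp.not_dvd_one
    · intro n hn
      rw [hdeg] at hn
      rw [Ideal.mem_span_singleton]
      interval_cases n <;> simp [hp, coeff_X_pow, coeff_natCast_ite, ha]
    · rw [Ideal.span_singleton_pow, Ideal.mem_span_singleton]
      intro h
      have h' : (l : ℤ) * l ∣ l * 1 := by simpa [hp, sq] using h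
      exact hlp.not_dvd_one (Int.dvd_of_mul_dvd_mul_left hlp.ne_zero h')
  have := (hmon.irreducible_iff_irreducible_map_fraction_map (K := ℚ)).1 hirr
  simpa [hp] using this

theorem adjoin_structure {l : ℕ} (hl : l.Prime) {T U : ℤ}
    (hTU : T ^ 2 + 1 = l * U ^ 2) (hU : 0 < U) {K : IntermediateField ℚ ℝ} [NumberField K]
    (hK : K = adjoin ℚ {√((T + U * √(l : ℝ)) * √(l : ℝ))}) :
    Module.finrank ℚ K = 4 ∧ ∃ (s θ : K) (σ : Gal(K/ℚ)), s ^ 2 = l ∧ θ ^ 2 = U * l + T * s ∧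
      σ s = -s ∧ σ θ = θ * (U * s - T) ∧ IsGalois ℚ K ∧ (∀ τ, τ ∈ Subgroup.zpowers σ) ∧
      σ ^ 4 = 1 := by
  have hs : √(l : ℝ) ^ 2 = l := Real.sq_sqrt l.cast_nonneg
  have hl0 : (0 : ℝ) < l := by exact_mod_cast hl.pos
  have hs0 : 0 < √(l : ℝ) := Real.sqrt_pos.2 hl0
  have hT : T ≠ 0 := by
    rintro rfl
    have : (l : ℤ) ∣ 1 := ⟨U ^ 2, by linarith⟩
    exact (Nat.prime_iff_prime_int.1 hl).not_dvd_one this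
  have hTU' : (T : ℝ) ^ 2 + 1 = l * U ^ 2 := by exact_mod_cast hTU
  have hpos : 0 < (T + U * √(l : ℝ)) * √(l : ℝ) := by
    have : (0 : ℝ) < U := by exact_mod_cast hU
    have : -(T : ℝ) < U * √l := lt_of_pow_lt_pow_left₀ 2 (by positivity) (by nlinarith)
    exact mul_pos (by linarith) hs0
  generalize hr : √((T + U * √(l : ℝ)) * √(l : ℝ)) = r at hK
  have hr0 : r ≠ 0 := hr ▸ (Real.sqrt_pos.2 hpos).ne'
  have hr2 : r ^ 2 = U * l + T * √l := by
    rw [← hr, Real.sq_sqrt hpos.le]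
    linear_combination (U : ℝ) * hs
  have hirr := irreducible_quartic hl (dvd_mul_left (l : ℤ) (2 * U))
  set p := X ^ 4 - C ((2 * U * l : ℤ) : ℚ) * X ^ 2 +
      C (l : ℚ) with hp
  have hmon : p.Monic := by rw [hp]; monicity!
  have hdeg : p.natDegree = 4 := by rw [hp]; compute_degree!
  have hpr : Polynomial.aeval r p = 0 := by
    simp only [hp, map_add, map_sub, map_mul, map_pow, Polynomial.aeval_X, Polynomial.aeval_C]
    simp only [map_intCast, map_natCast, Int.cast_mul, Int.cast_natCast, Int.cast_ofNat, map_mul,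
      map_ofNat]
    linear_combination (r ^ 2 + T * √l - U * l) * hr2 + (T : ℝ) ^ 2 * hs + l * hTU'
  have hmin : minpoly ℚ r = p := (minpoly.eq_of_irreducible_of_monic hirr hpr hmon).symm
  have hInt : IsIntegral ℚ r := ⟨p, hmon, hpr⟩
  subst hK
  let θ := AdjoinSimple.gen ℚ r
  obtain ⟨s, hs2, hθ⟩ : ∃ s : ℚ⟮r⟯, s ^ 2 = l ∧ θ ^ 2 = U * l + T * s := by
    have hT' : (T : ℚ⟮r⟯) ≠ 0 := by exact_mod_cast hT
    refine ⟨(θ ^ 2 - U * l) / T, ?_, by field_simp; ring⟩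
    apply (algebraMap ℚ⟮r⟯ ℝ).injective
    have hT' : (T : ℝ) ≠ 0 := by exact_mod_cast hT
    simp only [map_pow, map_div₀, map_sub, map_mul, map_intCast, map_natCast, θ,
      AdjoinSimple.algebraMap_gen, hr2]
    field_simp
    linear_combination (T : ℝ) ^ 2 * hs
  have hθ0 : θ ≠ 0 := fun h ↦ hr0 (congrArg (algebraMap ℚ⟮r⟯ ℝ) h)
  have hTU'' : (T : ℚ⟮r⟯) ^ 2 + 1 = l * U ^ 2 := by exact_mod_cast hTU
  have hy2 : (θ * (U * s - T)) ^ 2 = U * l - T * s := by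
    rw [mul_pow, hθ]
    linear_combination (U ^ 3 * l + T * U ^ 2 * s - 2 * U * T ^ 2) * hs2 + (T * s - U * l) * hTU''
  have hy : θ * (U * s - T) ∈ (minpoly ℚ r).aroots ℚ⟮r⟯ := by
    rw [hmin, Polynomial.mem_aroots]
    refine ⟨hmon.ne_zero, ?_⟩
    simp only [hp, map_add, map_sub, map_mul, map_pow, Polynomial.aeval_X, Polynomial.aeval_C]
    simp only [map_intCast, map_natCast, Int.cast_mul, Int.cast_natCast, Int.cast_ofNat, map_mul,
      map_ofNat]
    linear_combination ((θ * (U * s - T)) ^ 2 - T * s - U * l) * hy2 + T ^ 2 * hs2 + l * hTU''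
  let σ₀ := (algHomAdjoinIntegralEquiv ℚ hInt).symm ⟨_, hy⟩
  let σ : Gal(ℚ⟮r⟯/ℚ) := AlgEquiv.ofBijective σ₀ σ₀.bijective
  have hσθ : σ θ = θ * (U * s - T) :=
    algHomAdjoinIntegralEquiv_symm_apply_gen ℚ hInt ⟨_, hy⟩
  have hσs : σ s = -s := by
    have := congrArg σ hθ
    simp only [map_pow, hσθ, hy2, map_add, map_mul, map_natCast, map_intCast] at this
    have hT' : (T : ℚ⟮r⟯) ≠ 0 := by exact_mod_cast hT
    apply mul_left_cancel₀ hT'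
    linear_combination -this
  have hσ2 : σ (σ θ) = -θ := by
    rw [hσθ, map_mul, map_sub, map_mul, map_intCast, map_intCast, hσs, hσθ]
    linear_combination θ * hTU'' - θ * U ^ 2 * hs2
  have hσ4 : σ ^ 4 = 1 := by
    have h4 : (σ ^ 4) θ = θ := by
      change σ (σ (σ (σ θ))) = θ
      rw [hσ2, map_neg, map_neg, hσ2, neg_neg]
    refine AlgEquiv.coe_toAlgHom_injective
      (algHom_ext_of_eq_adjoin ℚ rfl fun x hx ↦ ?_)
    have hx' : (⟨x, subset_adjoin ℚ _ hx⟩ : ℚ⟮r⟯) = θ := Subtype.ext hx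
    exact (congrArg (⇑(σ ^ 4)) hx').trans (h4.trans hx'.symm)
  have hfin : Module.finrank ℚ ℚ⟮r⟯ = 4 := by
    rw [adjoin.finrank hInt, hmin, hdeg]
  have hord : orderOf σ = 4 := by
    refine orderOf_eq_prime_pow (p := 2) (n := 1) (fun h ↦ ?_) hσ4
    have := DFunLike.congr_fun h θ
    have : σ (σ θ) = θ := this
    rw [hσ2] at this
    exact hθ0 (self_eq_neg.1 this.symm)
  have hcard : Nat.card Gal(ℚ⟮r⟯/ℚ) = 4 := by
    apply le_antisymm
    · rw [← hfin, Nat.card_eq_fintype_card]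
      exact AlgEquiv.card_le
    · rw [← hord]
      exact orderOf_le_card
  refine ⟨hfin, s, θ, σ, hs2, hθ, hσs, hσθ, .of_card_aut_eq_finrank _ _ (hcard.trans hfin.symm), ?_,
    hσ4⟩
  have := Subgroup.eq_top_of_card_eq (Subgroup.zpowers σ) (by rw [Nat.card_zpowers, hord, hcard])
  exact fun τ ↦ this ▸ Subgroup.mem_top τ

theorem inertia_eq_bot_of_sq_notMem {G R : Type*} [Group G] [CommRing R] [MulSemiringAction G R]
    {σ : G} (hσ : ∀ τ, τ ∈ Subgroup.zpowers σ) (hσ4 : σ ^ 4 = 1) {P : Ideal R}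
    (h : σ ^ 2 ∉ P.inertia G) : P.inertia G = ⊥ := by
  rw [Subgroup.eq_bot_iff_forall]
  intro τ hτ
  obtain ⟨k, rfl⟩ := Subgroup.mem_zpowers_iff.1 (hσ τ)
  rw [zpow_eq_zpow_emod' k hσ4] at hτ ⊢
  have hk : k % (4 : ℕ) = 0 ∨ k % (4 : ℕ) = 1 ∨ k % (4 : ℕ) = 2 ∨ k % (4 : ℕ) = 3 := by omega
  rcases hk with hk | hk | hk | hk <;> rw [hk] at hτ ⊢
  · exact zpow_zero σ
  · exact absurd (pow_mem (by simpa using hτ) 2) h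
  · exact absurd (mod_cast hτ) h
  · have hsq : (σ ^ (3 : ℤ)) ^ 2 = σ ^ 2 := by
      calc (σ ^ (3 : ℤ)) ^ 2 = σ ^ 4 * σ ^ 2 := by group
        _ = σ ^ 2 := by rw [hσ4, one_mul]
    exact absurd (hsq ▸ pow_mem hτ 2) h

theorem one_lt_rank_of_finrank_eq_four {K : Type*} [Field K] [NumberField K] (φ : K →+* ℝ)
    (h : Module.finrank ℚ K = 4) : 1 < Units.rank K := by
  have h1 := InfinitePlace.card_add_two_mul_card_eq_rank K
  have h2 := InfinitePlace.card_eq_nrRealPlaces_add_nrComplexPlaces K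
  have hreal : ComplexEmbedding.IsReal (Complex.ofRealHom.comp φ) := by
    ext x
    simp
  classical
  have h3 : 0 < InfinitePlace.nrRealPlaces K :=
    Fintype.card_pos_iff.2 ⟨⟨_, InfinitePlace.isReal_mk_iff.2 hreal⟩⟩
  rw [Units.rank]
  omega

theorem classGroup_sq_eq_one_imp {K : Type} [Field K] [NumberField K] [IsGalois ℚ K] {l : ℕ}
    (hl : l.Prime) (φ : K →+* ℝ) (hfin : Module.finrank ℚ K = 4) {T U : ℤ}
    (hTU : T ^ 2 + 1 = l * U ^ 2) (hT : 4 ∣ T) (hU : 4 ∣ U * l - 1)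
    {s θ : K} {σ : Gal(K/ℚ)} (hs : s ^ 2 = l) (hθ : θ ^ 2 = U * l + T * s) (hσs : σ s = -s)
    (hσθ : σ θ = θ * (U * s - T)) (hσ : ∀ τ, τ ∈ Subgroup.zpowers σ) (hσ4 : σ ^ 4 = 1)
    (x : ClassGroup (𝓞 K)) (hx : x ^ 2 = 1) : x = 1 := by
  have hTU' : (T : K) ^ 2 + 1 = l * U ^ 2 := by exact_mod_cast hTU
  have hcast (n : ℤ) : IsIntegral ℤ (n : K) := isIntegral_algebraMap (R := ℤ)
  have hsint : IsIntegral ℤ s := .of_pow two_pos (by rw [hs]; exact_mod_cast hcast l)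
  have hθint : IsIntegral ℤ θ := .of_pow two_pos <| by
    rw [hθ]
    exact_mod_cast (hcast (U * l)).add ((hcast T).mul hsint)
  obtain ⟨s, rfl⟩ : ∃ s' : 𝓞 K, algebraMap (𝓞 K) K s' = s := ⟨⟨s, hsint⟩, rfl⟩
  obtain ⟨θ, rfl⟩ : ∃ θ' : 𝓞 K, algebraMap (𝓞 K) K θ' = θ := ⟨⟨θ, hθint⟩, rfl⟩
  have hs' : s ^ 2 = l := RingOfIntegers.ext (by simpa using hs)
  have hθ' : θ ^ 2 = U * l + T * s := RingOfIntegers.ext (by simpa using hθ)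
  have hTU'' : (T : 𝓞 K) ^ 2 + 1 = l * U ^ 2 := by exact_mod_cast hTU'
  have hσs' : σ • s = -s := RingOfIntegers.ext (hσs.trans (by simp))
  have hσθ' : σ • θ = θ * (U * s - T) := RingOfIntegers.ext (hσθ.trans (by simp))
  let ε : (𝓞 K)ˣ := Units.mkOfMulEqOne (T + U * s) (U * s - T) (by
    linear_combination (U : 𝓞 K) ^ 2 * hs' - hTU'')
  have hε : (ε : 𝓞 K) = T + U * s := rfl
  have hcast (n : ℤ) : σ • (n : 𝓞 K) = n := map_intCast (MulSemiringAction.toRingHom _ _ σ) n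
  have hεσ : (ε : 𝓞 K) * σ • (ε : 𝓞 K) = -1 := by
    rw [hε, smul_add, smul_mul', hcast, hcast, hσs']
    linear_combination hTU'' - (U : 𝓞 K) ^ 2 * hs'
  have hθσ : θ = ε * σ • θ := by
    rw [hσθ', hε]
    linear_combination θ * (hTU'' - (U : 𝓞 K) ^ 2 * hs')
  have hσ2θ : σ ^ 2 • θ = -θ := by
    rw [sq, mul_smul, hσθ', smul_mul', smul_sub, smul_mul', hcast, hcast, hσs', hσθ']
    linear_combination θ * (hTU'' - (U : 𝓞 K) ^ 2 * hs')
  have hθ4 : θ ^ 4 = ((ε ^ 2 : (𝓞 K)ˣ) : 𝓞 K) * l := by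
    rw [Units.val_pow_eq_pow_val, hε]
    linear_combination (θ ^ 2 + U * l + T * s) * hθ' + (T ^ 2 - U ^ 2 * l) * hs'
  have hl0 : (l : 𝓞 K) ≠ 0 := by exact_mod_cast hl.ne_zero
  have hθ0 : θ ≠ 0 := by
    rintro rfl
    rw [zero_pow four_ne_zero, eq_comm, Units.mul_right_eq_zero] at hθ4
    exact hl0 hθ4
  have hprime : Prime θ := by
    refine Ideal.prime_of_irreducible_absNorm_span hθ0 ?_
    have : Ideal.absNorm (span {θ}) ^ 4 = l ^ 4 := by
      rw [← map_pow, Ideal.span_singleton_pow, hθ4,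
        Ideal.span_singleton_mul_left_unit (Units.isUnit _), Ideal.absNorm_span_natCast,
        RingOfIntegers.rank, hfin]
    rw [Nat.pow_left_injective four_ne_zero this]
    exact hl
  obtain ⟨ω, hω⟩ : ∃ ω : 𝓞 K, 2 * ω = 1 + θ := by
    obtain ⟨t, rfl⟩ := hT
    obtain ⟨u, hu⟩ := hU
    have hu' : (U : K) * l - 1 = 4 * u := by exact_mod_cast hu
    have hroot : ((1 + algebraMap (𝓞 K) K θ) / 2) ^ 2 - (1 + algebraMap (𝓞 K) K θ) / 2 =
        algebraMap (𝓞 K) K (u + t * s) := by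
      push_cast at hθ
      simp only [map_add, map_mul, map_intCast]
      linear_combination hθ / 4 + hu' / 4
    have hInt : IsIntegral (𝓞 K) ((1 + algebraMap (𝓞 K) K θ) / 2) := by
      refine ⟨X ^ 2 - X - C (u + t * s : 𝓞 K), by monicity!, ?_⟩
      simp [← aeval_def, hroot]
    obtain ⟨ω, hω⟩ := IsIntegrallyClosed.isIntegral_iff.1 hInt
    refine ⟨ω, RingOfIntegers.ext ?_⟩
    simp only [map_mul, map_ofNat, hω, map_add, map_one]
    ring
  refine classGroup_eq_one_of_sq_eq_one (fun I ↦ isPrincipal_of_sq_isPrincipal hσ hσ4 hprime ?_ hθσ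
    hεσ (one_lt_rank_of_finrank_eq_four φ hfin)) x hx
  intro P hP hP0 hθP
  refine inertia_eq_bot_of_sq_notMem hσ hσ4 fun hmem ↦ hθP ?_
  have := AddSubgroup.mem_inertia.1 hmem ω
  have h2 : σ ^ 2 • ω - ω = -θ := by
    apply mul_left_cancel₀ (two_ne_zero (α := 𝓞 K))
    have := congrArg (σ ^ 2 • ·) hω
    simp only [two_mul, smul_add, smul_one, hσ2θ] at this
    linear_combination this - hω
  rw [h2] at this
  exact neg_mem_iff.1 this

end

/-- for a prime `l ≡ 1 (mod 8)` and `n = 1`, the 2-class group of the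
real cyclic quartic field `𝕂 = ℚ(√(ε₀√l))` is trivial, i.e. `r₂(H) = 0`. -/
theorem stmt_0 (l : ℕ) (hl : l.Prime) (hl8 : l % 8 = 1)
    (ε₀ : ℝ) (hε : IsFundamentalUnit l ε₀)
    (hεnorm : ∃ u v : ℚ, ε₀ = (u : ℝ) + (v : ℝ) * Real.sqrt (l : ℝ) ∧
      (u : ℝ) ^ 2 - (v : ℝ) ^ 2 * (l : ℝ) = -1)
    (K : IntermediateField ℚ ℝ)
    (hK : K = IntermediateField.adjoin ℚ
      ({Real.sqrt (ε₀ * Real.sqrt (l : ℝ))} : Set ℝ))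
    [NumberField K] :
    twoTorsCard K = 2 ^ 0 := by
  obtain ⟨u, v, huv, hnorm⟩ := hεnorm
  obtain ⟨h1, -, hInt, hInt', -⟩ := hε
  obtain ⟨T, U, rfl, hTU, hU⟩ := exists_eq_add_mul_sqrt hl hl8 h1 hInt hInt' huv hnorm
  obtain ⟨hT4, hU4⟩ := four_dvd_of_sq_add_one_eq hl8 hU hTU
  obtain ⟨hfin, s, θ, σ, hs, hθ, hσs, hσθ, hGal, hσ, hσ4⟩ := adjoin_structure hl hTU hU hK
  have hUl : 4 ∣ U * l - 1 := by
    obtain ⟨a, ha⟩ := hU4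
    obtain ⟨b, hb⟩ : ∃ b : ℤ, (l : ℤ) = 8 * b + 1 := ⟨l / 8, by omega⟩
    exact ⟨a * l + 2 * b, by rw [hb]; linear_combination (8 * b + 1) * ha⟩
  have key := classGroup_sq_eq_one_imp hl (algebraMap K ℝ) hfin hTU hT4 hUl hs hθ hσs hσθ hσ hσ4
  have : Unique {x : ClassGroup (NumberField.RingOfIntegers K) // x ^ 2 = 1} :=
    ⟨⟨⟨1, one_pow 2⟩⟩, fun x ↦ Subtype.ext (key x x.2)⟩
  rw [pow_zero]
  exact Nat.card_unique
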